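/- arXiv:2601.21773 — 3 statements merged into one kernel-verified Lean document; each statement's English description precedes it below -/
import Mathlib

section
/- Claim (Rankine–Hugoniot (2)): If the Rankine–Hugoniot relation holds, then π_II · sinh(2(W_II − Z)) = π_I · sinh(2(W_I − Z)). -/
open Real

/-- Squared Euclidean norm of a vector. -/
noncomputable def nsq {n : ℕ} (w : Fin n → ℝ) : ℝ := ∑ j, (w j) ^ 2

/-- Minkowski bilinear form on `ℝ^{d+1}`: `η(x,y) = -x₀y₀ + ∑_{j=1}^d xⱼyⱼ`. -/
noncomputable def eta {d : ℕ} (x y : Fin (d + 1) → ℝ) : ℝ :=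
  -(x 0 * y 0) + ∑ j : Fin d, x j.succ * y j.succ

/-- Unit spacelike normal `V = (sinh Z, cosh Z, 0, …, 0)` to the interface. -/
noncomputable def normalV (d : ℕ) (Z : ℝ) : Fin (d + 1) → ℝ := fun i =>
  if i.val = 0 then Real.sinh Z else if i.val = 1 then Real.cosh Z else 0

/-- Unit timelike fluid velocity determined by the perpendicular rapidity `W` and
the parallel velocity `w ∈ ℝ^{d-1}`. -/
noncomputable def vel (d : ℕ) (W : ℝ) (w : Fin (d - 1) → ℝ) : Fin (d + 1) → ℝ := fun i =>
  if i.val = 0 then Real.sqrt (1 + nsq w) * Real.cosh W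
  else if i.val = 1 then Real.sqrt (1 + nsq w) * Real.sinh W
  else if h : i.val - 2 < d - 1 then w ⟨i.val - 2, h⟩ else 0

/-- The Rankine–Hugoniot relation
`(μ_II + p_II) η(u_II,V) u_II − (μ_I + p_I) η(u_I,V) u_I + (p_II − p_I) V = 0`. -/
def RH (d : ℕ) (μI pI μII pII : ℝ) (uI uII V : Fin (d + 1) → ℝ) : Prop :=
  ∀ i, (μII + pII) * eta uII V * uII i - (μI + pI) * eta uI V * uI i + (pII - pI) * V i = 0

/-- Pairing the fluid velocity with the interface normal: `η(u, V) = √(1 + |w|²) sinh (W - Z)`. -/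
theorem eta_vel_normalV {d : ℕ} (hd : 1 ≤ d) (Z W : ℝ) (w : Fin (d - 1) → ℝ) :
    eta (vel d W w) (normalV d Z) = √(1 + nsq w) * Real.sinh (W - Z) := by
  obtain ⟨n, rfl⟩ : ∃ n, d = n + 1 := ⟨d - 1, by omega⟩
  simp only [eta, Fin.sum_univ_succ]
  simp [vel, normalV, Real.sinh_sub]
  ring

theorem nsq_nonneg {n : ℕ} (w : Fin n → ℝ) : 0 ≤ nsq w :=
  Finset.sum_nonneg fun _ _ => sq_nonneg _

/-- Rankine–Hugoniot (2): π_II sinh(2(W_II − Z)) = π_I sinh(2(W_I − Z)). -/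
theorem rankine_hugoniot_two (d : ℕ) (hd : 2 ≤ d) (Z μI μII pI pII WI WII : ℝ)
    (wI wII : Fin (d - 1) → ℝ) (hμI : 0 ≤ μI) (hμII : 0 ≤ μII)
    (hRH : RH d μI pI μII pII (vel d WI wI) (vel d WII wII) (normalV d Z)) :
    ((μII + pII) * (1 + nsq wII)) * Real.sinh (2 * (WII - Z))
      = ((μI + pI) * (1 + nsq wI)) * Real.sinh (2 * (WI - Z)) := by
  have h₀ := hRH ⟨0, by omega⟩
  have h₁ := hRH ⟨1, by omega⟩
  rw [eta_vel_normalV (by omega), eta_vel_normalV (by omega)] at h₀ h₁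
  simp only [vel, normalV, if_true, one_ne_zero, if_false] at h₀ h₁
  have sI : √(1 + nsq wI) ^ 2 = 1 + nsq wI := Real.sq_sqrt (by linarith [nsq_nonneg wI])
  have sII : √(1 + nsq wII) ^ 2 = 1 + nsq wII := Real.sq_sqrt (by linarith [nsq_nonneg wII])
  rw [← sI, ← sII, Real.sinh_two_mul, Real.sinh_two_mul, Real.cosh_sub WI, Real.cosh_sub WII]
  -- Contract the relation with the tangent `(cosh Z, sinh Z, 0, …, 0)`, which is `η`-orthogonal to `V`.
  linear_combination 2 * Real.cosh Z * h₀ - 2 * Real.sinh Z * h₁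
end

section
/- Invariant form of the Hugoniot relations, second identity: assume the Rankine–Hugoniot relation holds, W_I ≠ Z, the positivity conditions μ_I + p_I > 0, μ_II + p_II > 0, μ_I + p_II > 0, μ_II + p_I > 0, and μ_I − p_I ≠ μ_II − p_II. Then for each phase φ ∈ {I, II}: (η(V, u_φ))² · (μ_I − p_I − μ_II + p_II)(μ_φ + p_φ) = (p_I − p_II)(μ_I + μ_II − μ_φ + p_φ). -/
open Real

theorem eta_comm {d : ℕ} (x y : Fin (d + 1) → ℝ) : eta x y = eta y x := by
  simp only [eta, mul_comm]

theorem eta_normalV_self {d : ℕ} (hd : 1 ≤ d) (Z : ℝ) :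
    eta (normalV d Z) (normalV d Z) = 1 := by
  obtain ⟨k, rfl⟩ := Nat.exists_eq_add_of_le' hd
  simp [eta, normalV]
  linarith [Real.cosh_sq Z]

theorem eta_vel_self {d : ℕ} (hd : 1 ≤ d) (W : ℝ) (w : Fin (d - 1) → ℝ) :
    eta (vel d W w) (vel d W w) = -1 := by
  obtain ⟨k, rfl⟩ := Nat.exists_eq_add_of_le' hd
  have hnonneg : 0 ≤ nsq w := Finset.sum_nonneg fun j _ => sq_nonneg (w j)
  have hsqrt := Real.sq_sqrt (add_nonneg zero_le_one hnonneg)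
  have htail : ∑ j : Fin k, vel (k + 1) W w j.succ.succ * vel (k + 1) W w j.succ.succ
      = nsq w := by
    refine Finset.sum_congr rfl fun j _ => ?_
    simp [vel, sq]
  have hzero : vel (k + 1) W w 0 = √(1 + nsq w) * cosh W := by simp [vel]
  have hone : vel (k + 1) W w (Fin.succ 0) = √(1 + nsq w) * sinh W := by simp [vel]
  rw [eta, Fin.sum_univ_succ, htail, hzero, hone]
  linear_combination (-(cosh W ^ 2 - sinh W ^ 2)) * hsqrt - (1 + nsq w) * Real.cosh_sq W

/-- The Rankine–Hugoniot relation paired with an arbitrary vector. -/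
theorem RH.eta_eq_zero {d : ℕ} {μI pI μII pII : ℝ} {uI uII V : Fin (d + 1) → ℝ}
    (h : RH d μI pI μII pII uI uII V) (y : Fin (d + 1) → ℝ) :
    (μII + pII) * eta uII V * eta uII y - (μI + pI) * eta uI V * eta uI y
      + (pII - pI) * eta V y = 0 := by
  have hsum : ∑ j : Fin d, ((μII + pII) * eta uII V * uII j.succ
      - (μI + pI) * eta uI V * uI j.succ + (pII - pI) * V j.succ) * y j.succ = 0 :=
    Finset.sum_eq_zero fun j _ => by rw [h j.succ, zero_mul]
  simp only [add_mul, sub_mul, mul_assoc, Finset.sum_add_distrib, Finset.sum_sub_distrib,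
    ← Finset.mul_sum] at hsum
  have hzero := h 0
  rw [eta.eq_1 uII y, eta.eq_1 uI y, eta.eq_1 V y]
  linear_combination hsum - y 0 * hzero

/-- Invariant form of the Hugoniot relations, second identity (both phases). -/
theorem hugoniot_invariant_second (d : ℕ) (hd : 2 ≤ d) (Z μI μII pI pII WI WII : ℝ)
    (wI wII : Fin (d - 1) → ℝ) (hμI : 0 ≤ μI) (hμII : 0 ≤ μII)
    (hW : WI ≠ Z)
    (h1 : 0 < μI + pI) (h2 : 0 < μII + pII) (h3 : 0 < μI + pII) (h4 : 0 < μII + pI)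
    (hne : μI - pI ≠ μII - pII)
    (hRH : RH d μI pI μII pII (vel d WI wI) (vel d WII wII) (normalV d Z)) :
    (eta (normalV d Z) (vel d WI wI)) ^ 2 * ((μI - pI - μII + pII) * (μI + pI))
        = (pI - pII) * (μI + μII - μI + pI)
      ∧ (eta (normalV d Z) (vel d WII wII)) ^ 2 * ((μI - pI - μII + pII) * (μII + pII))
        = (pI - pII) * (μI + μII - μII + pII) := by
  have hd' : 1 ≤ d := one_le_two.trans hd
  have hV := hRH.eta_eq_zero (normalV d Z)
  have hI := hRH.eta_eq_zero (vel d WI wI)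
  have hII := hRH.eta_eq_zero (vel d WII wII)
  rw [eta_normalV_self hd'] at hV
  rw [eta_vel_self hd', eta_comm (normalV d Z), eta_comm (vel d WII wII) (vel d WI wI)] at hI
  rw [eta_vel_self hd', eta_comm (normalV d Z)] at hII
  rw [eta_comm (normalV d Z), eta_comm (normalV d Z)]
  generalize eta (vel d WI wI) (normalV d Z) = a at *
  generalize eta (vel d WII wII) (normalV d Z) = b at *
  generalize eta (vel d WI wI) (vel d WII wII) = c at *
  have hnorm : (μI + pI) ^ 2 * a ^ 2 - (μII + pII) ^ 2 * b ^ 2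
      + (pII - pI) * ((μII + pII) * b ^ 2 + (μI + pI) * a ^ 2) = 0 := by
    linear_combination (μII + pII) * b * hII + (μI + pI) * a * hI
  have hfirst : a ^ 2 * ((μI - pI - μII + pII) * (μI + pI))
      = (pI - pII) * (μI + μII - μI + pI) := by
    linear_combination hnorm + (μII + pI) * hV
  refine ⟨hfirst, ?_⟩
  linear_combination hfirst + (μI - pI - μII + pII) * hV
end

section
/- Strict separation of characteristic speeds: let 0 < k ≤ 1, u₁ ∈ ℝ, w ≥ 0, u₀ := (1 + u₁² + w)^{1/2}, and let λ_± := ((1 − k²) u₀ u₁ ± k (1 + (1 − k²) w)^{1/2}) / (k² + (1 − k²) u₀²) be the two acoustic wave speeds. Then λ_− < u₁/u₀ < λ_+; that is, the fluid speed λ⁰ = u₁/u₀ lies strictly between the left-hand and right-hand acoustic wave speeds. -/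
open Real

/-- Strict separation of characteristic speeds: the fluid speed u₁/u₀ lies strictly
between the left- and right-hand acoustic wave speeds. -/
theorem characteristic_speeds_separation (k u₁ w : ℝ) (hk0 : 0 < k) (hk1 : k ≤ 1)
    (hw : 0 ≤ w) (u₀ : ℝ) (hu₀ : u₀ = Real.sqrt (1 + u₁ ^ 2 + w)) :
    ((1 - k ^ 2) * u₀ * u₁ - k * Real.sqrt (1 + (1 - k ^ 2) * w))
        / (k ^ 2 + (1 - k ^ 2) * u₀ ^ 2) < u₁ / u₀
      ∧ u₁ / u₀ < ((1 - k ^ 2) * u₀ * u₁ + k * Real.sqrt (1 + (1 - k ^ 2) * w))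
        / (k ^ 2 + (1 - k ^ 2) * u₀ ^ 2) := by
  have hu_pos : 0 < u₀ := hu₀ ▸ Real.sqrt_pos.2 (by positivity)
  have hu_abs : |u₁| < u₀ := by
    rw [hu₀]
    exact Real.lt_sqrt_of_sq_lt (by rw [sq_abs]; linarith)
  have hk : 0 ≤ 1 - k ^ 2 := by nlinarith
  set s := Real.sqrt (1 + (1 - k ^ 2) * w)
  have hs : 1 ≤ s := Real.one_le_sqrt.2 (by nlinarith [mul_nonneg hk hw])
  have hden : 0 < k ^ 2 + (1 - k ^ 2) * u₀ ^ 2 := by positivity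
  have key : k * |u₁| < s * u₀ := calc
    k * |u₁| ≤ s * |u₁| := by gcongr; exact hk1.trans hs
    _ < s * u₀ := by gcongr
  have hlow := mul_le_mul_of_nonneg_left (neg_abs_le u₁) hk0.le
  have hupp := mul_le_mul_of_nonneg_left (le_abs_self u₁) hk0.le
  constructor
  · rw [div_lt_div_iff₀ hden hu_pos]
    linear_combination k * (key + hlow)
  · rw [div_lt_div_iff₀ hu_pos hden]
    linear_combination k * (key + hupp)
end
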